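/- Suppose that at every (t,x) the equations ∂_t c̃ + u₁∂₁c̃ + u₂∂₂c̃ + c̃ (div_Γ u) = γ Δ_Γ c̃ and ∂_t η = (u · ν) √(1+|∇_*η|²) hold. Then the total surfactant mass is conserved: the map t ↦ ∫_Q c̃(t,·) √(1+|∇_*η(t,·)|²) dx is constant in t (equivalently, its derivative vanishes for every t). -/

import Mathlib

open Real MeasureTheory

noncomputable section

/-- The horizontal plane ℝ². -/
abbrev E2 := EuclideanSpace ℝ (Fin 2)

/-- Partial derivative ∂ᵢ of a function on ℝ². -/
noncomputable def pd (i : Fin 2) (f : E2 → ℝ) : E2 → ℝ :=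
  fun x => fderiv ℝ f x (EuclideanSpace.single i 1)

/-- 1 + |∇_*η|². -/
noncomputable def nsq (η : E2 → ℝ) (x : E2) : ℝ :=
  1 + ((pd 0 η x) ^ 2 + (pd 1 η x) ^ 2)

/-- The unit normal ν = (−∂₁η, −∂₂η, 1)/√(1+|∇_*η|²). -/
noncomputable def nu (η : E2 → ℝ) (i : Fin 3) (x : E2) : ℝ :=
  ![-(pd 0 η x), -(pd 1 η x), 1] i / Real.sqrt (nsq η x)

/-- The tangential derivative factor ν₁∂₁f + ν₂∂₂f. -/
noncomputable def tang (η f : E2 → ℝ) (x : E2) : ℝ :=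
  nu η 0 x * pd 0 f x + nu η 1 x * pd 1 f x

/-- The surface derivatives ∂_{Γ,i}. -/
noncomputable def surfD (η : E2 → ℝ) (i : Fin 3) (f : E2 → ℝ) : E2 → ℝ :=
  fun x => ![pd 0 f x, pd 1 f x, (0 : ℝ)] i - nu η i x * tang η f x

/-- Surface divergence div_Γ X = Σᵢ ∂_{Γ,i} Xᵢ. -/
noncomputable def divGamma (η : E2 → ℝ) (X : Fin 3 → E2 → ℝ) (x : E2) : ℝ :=
  ∑ i : Fin 3, surfD η i (X i) x

/-- Surface Laplacian Δ_Γ g = div_Γ (∇_Γ g). -/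
noncomputable def lapGamma (η g : E2 → ℝ) (x : E2) : ℝ :=
  ∑ i : Fin 3, surfD η i (surfD η i g) x

/-- The mean curvature H = div_*(∇_*η/√(1+|∇_*η|²)). -/
noncomputable def meanH (η : E2 → ℝ) (x : E2) : ℝ :=
  pd 0 (fun y => pd 0 η y / Real.sqrt (nsq η y)) x
    + pd 1 (fun y => pd 1 η y / Real.sqrt (nsq η y)) x

/-- Periodicity with periods L₁, L₂ in the two horizontal directions. -/
def PeriodicE2 (L₁ L₂ : ℝ) (f : E2 → ℝ) : Prop :=
  (∀ x : E2, f (x + L₁ • EuclideanSpace.single 0 1) = f x) ∧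
  (∀ x : E2, f (x + L₂ • EuclideanSpace.single 1 1) = f x)

/-- The fundamental periodicity cell Q = [0,L₁] × [0,L₂]. -/
def Q2 (L₁ L₂ : ℝ) : Set E2 := {x : E2 | x 0 ∈ Set.Icc 0 L₁ ∧ x 1 ∈ Set.Icc 0 L₂}

end

section helpers

lemma smd {V : Type*} [NormedAddCommGroup V] [NormedSpace ℝ V] {f : V → ℝ}
    (hf : ContDiff ℝ (⊤ : ℕ∞) f) : Differentiable ℝ f :=
  hf.differentiable (by simp)

lemma smd_fderiv {V : Type*} [NormedAddCommGroup V] [NormedSpace ℝ V] {f : V → ℝ}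
    (hf : ContDiff ℝ (⊤ : ℕ∞) f) (v : V) :
    ContDiff ℝ (⊤ : ℕ∞) (fun x => fderiv ℝ f x v) :=
  (hf.fderiv_right (m := (⊤ : ℕ∞)) (by simp)).clm_apply contDiff_const

lemma fderiv_symm {V : Type*} [NormedAddCommGroup V] [NormedSpace ℝ V] {f : V → ℝ}
    (hf : ContDiff ℝ (⊤ : ℕ∞) f) (v w x : V) :
    fderiv ℝ (fun y => fderiv ℝ f y v) x w = fderiv ℝ (fun y => fderiv ℝ f y w) x v := by
  have h : IsSymmSndFDerivAt ℝ f x := hf.contDiffAt.isSymmSndFDerivAt (by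
    simp only [minSmoothness_of_isRCLikeNormedField]; exact WithTop.coe_le_coe.2 (le_top : (2 : ℕ∞) ≤ ⊤))
  have hd : DifferentiableAt ℝ (fderiv ℝ f) x :=
    ((hf.fderiv_right (m := (⊤ : ℕ∞)) (by simp)).differentiable (by simp)) x
  rw [fderiv_clm_apply hd (differentiableAt_const _), fderiv_clm_apply hd (differentiableAt_const _)]
  simp
  exact h.eq w v

lemma pd_smooth {f : E2 → ℝ} (hf : ContDiff ℝ (⊤ : ℕ∞) f) (i : Fin 2) :
    ContDiff ℝ (⊤ : ℕ∞) (pd i f) := smd_fderiv hf _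

lemma pd_symm {f : E2 → ℝ} (hf : ContDiff ℝ (⊤ : ℕ∞) f) (i j : Fin 2) (x : E2) :
    pd i (pd j f) x = pd j (pd i f) x := fderiv_symm hf _ _ x

lemma pd_mul {f g : E2 → ℝ} (hf : ContDiff ℝ (⊤ : ℕ∞) f) (hg : ContDiff ℝ (⊤ : ℕ∞) g)
    (i : Fin 2) (x : E2) :
    pd i (fun y => f y * g y) x = f x * pd i g x + g x * pd i f x := by
  unfold pd
  rw [fderiv_fun_mul (smd hf x) (smd hg x)]
  simp

lemma pd_sub {f g : E2 → ℝ} (hf : ContDiff ℝ (⊤ : ℕ∞) f) (hg : ContDiff ℝ (⊤ : ℕ∞) g)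
    (i : Fin 2) (x : E2) :
    pd i (fun y => f y - g y) x = pd i f x - pd i g x := by
  unfold pd
  rw [fderiv_fun_sub (smd hf x) (smd hg x)]
  simp

lemma nsq_pos (η : E2 → ℝ) (x : E2) : 0 < nsq η x := by
  unfold nsq; positivity

lemma nsq_smooth {η : E2 → ℝ} (hη : ContDiff ℝ (⊤ : ℕ∞) η) : ContDiff ℝ (⊤ : ℕ∞) (nsq η) :=
  contDiff_const.add (((pd_smooth hη 0).pow 2).add ((pd_smooth hη 1).pow 2))

lemma sq_smooth {η : E2 → ℝ} (hη : ContDiff ℝ (⊤ : ℕ∞) η) :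
    ContDiff ℝ (⊤ : ℕ∞) (fun x => Real.sqrt (nsq η x)) :=
  (nsq_smooth hη).sqrt (fun x => (nsq_pos η x).ne')

lemma nu_smooth {η : E2 → ℝ} (hη : ContDiff ℝ (⊤ : ℕ∞) η) (i : Fin 3) :
    ContDiff ℝ (⊤ : ℕ∞) (nu η i) := by
  unfold nu
  refine ContDiff.div ?_ (sq_smooth hη) (fun x => (Real.sqrt_pos.2 (nsq_pos η x)).ne')
  fin_cases i
  · exact (pd_smooth hη 0).neg
  · exact (pd_smooth hη 1).neg
  · exact contDiff_const

lemma surfD_smooth {η f : E2 → ℝ} (hη : ContDiff ℝ (⊤ : ℕ∞) η) (hf : ContDiff ℝ (⊤ : ℕ∞) f)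
    (i : Fin 3) : ContDiff ℝ (⊤ : ℕ∞) (surfD η i f) := by
  unfold surfD
  refine ContDiff.sub ?_ ((nu_smooth hη i).mul (((nu_smooth hη 0).mul (pd_smooth hf 0)).add
    ((nu_smooth hη 1).mul (pd_smooth hf 1))))
  fin_cases i
  · exact (pd_smooth hf 0)
  · exact (pd_smooth hf 1)
  · exact contDiff_const

lemma pd_sqrt {η : E2 → ℝ} (hη : ContDiff ℝ (⊤ : ℕ∞) η) (i : Fin 2) (x : E2) :
    pd i (fun y => Real.sqrt (nsq η y)) x =
      (pd 0 η x * pd i (pd 0 η) x + pd 1 η x * pd i (pd 1 η) x) / Real.sqrt (nsq η x) := by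
  have h1 : HasFDerivAt (nsq η) (((2 * pd 0 η x) • fderiv ℝ (pd 0 η) x)
      + ((2 * pd 1 η x) • fderiv ℝ (pd 1 η) x)) x := by
    have a := ((smd (pd_smooth hη 0)) x).hasFDerivAt.pow 2
    have b := ((smd (pd_smooth hη 1)) x).hasFDerivAt.pow 2
    have := (a.add b).const_add 1
    have e : nsq η = fun x => 1 + (pd 0 η x ^ 2 + pd 1 η x ^ 2) := rfl
    rw [e]
    simpa using this
  have h2 := h1.sqrt (nsq_pos η x).ne'
  change fderiv ℝ (fun y => Real.sqrt (nsq η y)) x _ = _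
  rw [h2.fderiv]
  have : Real.sqrt (nsq η x) ≠ 0 := (Real.sqrt_pos.2 (nsq_pos η x)).ne'
  simp [pd]
  field_simp

/-- The surface divergence written as a flat divergence plus a normal part. -/
lemma divGamma_eq {η : E2 → ℝ} (hη : ContDiff ℝ (⊤ : ℕ∞) η) {X : Fin 3 → E2 → ℝ}
    (hX : ∀ i, ContDiff ℝ (⊤ : ℕ∞) (X i)) (x : E2) :
    Real.sqrt (nsq η x) * divGamma η X x =
      pd 0 (fun y => Real.sqrt (nsq η y) * X 0 y) x
      + pd 1 (fun y => Real.sqrt (nsq η y) * X 1 y) x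
      + (pd 0 η x * pd 0 (fun y => X 2 y - X 0 y * pd 0 η y - X 1 y * pd 1 η y) x
        + pd 1 η x * pd 1 (fun y => X 2 y - X 0 y * pd 0 η y - X 1 y * pd 1 η y) x)
          / Real.sqrt (nsq η x) := by
  have hV : ∀ i, pd i (fun y => X 2 y - X 0 y * pd 0 η y - X 1 y * pd 1 η y) x =
      pd i (X 2) x - (X 0 x * pd i (pd 0 η) x + pd 0 η x * pd i (X 0) x)
        - (X 1 x * pd i (pd 1 η) x + pd 1 η x * pd i (X 1) x) := by
    intro i
    rw [pd_sub ((hX 2).sub ((hX 0).mul (pd_smooth hη 0))) ((hX 1).mul (pd_smooth hη 1)),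
      pd_sub (hX 2) ((hX 0).mul (pd_smooth hη 0)), pd_mul (hX 0) (pd_smooth hη 0),
      pd_mul (hX 1) (pd_smooth hη 1)]
  rw [hV, hV, pd_mul (sq_smooth hη) (hX 0), pd_mul (sq_smooth hη) (hX 1), pd_sqrt hη, pd_sqrt hη,
    pd_symm hη 0 1]
  have hs : Real.sqrt (nsq η x) ≠ 0 := (Real.sqrt_pos.2 (nsq_pos η x)).ne'
  simp only [divGamma, surfD, tang, nu, Fin.sum_univ_three]
  simp
  field_simp
  ring

lemma lapGamma_eq {η g : E2 → ℝ} (hη : ContDiff ℝ (⊤ : ℕ∞) η) (hg : ContDiff ℝ (⊤ : ℕ∞) g)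
    (x : E2) :
    Real.sqrt (nsq η x) * lapGamma η g x =
      pd 0 (fun y => Real.sqrt (nsq η y) * surfD η 0 g y) x
      + pd 1 (fun y => Real.sqrt (nsq η y) * surfD η 1 g y) x := by
  have h := divGamma_eq hη (X := fun i => surfD η i g) (fun i => surfD_smooth hη hg i) x
  have h0 : (fun y => surfD η 2 g y - surfD η 0 g y * pd 0 η y - surfD η 1 g y * pd 1 η y)
      = fun _ => 0 := by
    funext y
    have hs : Real.sqrt (nsq η y) ≠ 0 := (Real.sqrt_pos.2 (nsq_pos η y)).ne'
    have h2 : Real.sqrt (nsq η y) ^ 2 = 1 + ((pd 0 η y) ^ 2 + (pd 1 η y) ^ 2) :=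
      Real.sq_sqrt (nsq_pos η y).le
    simp only [surfD, tang, nu]
    simp
    field_simp
    rw [h2]
    ring
  have h1 : divGamma η (fun i => surfD η i g) x = lapGamma η g x := rfl
  rw [h1] at h
  simp only [h0] at h
  rw [h]
  simp [pd]

lemma pd_periodic {L₁ L₂ : ℝ} {f : E2 → ℝ} (hf : PeriodicE2 L₁ L₂ f) (i : Fin 2) :
    PeriodicE2 L₁ L₂ (pd i f) := by
  constructor
  · intro x
    have h : (fun x => f (x + L₁ • EuclideanSpace.single 0 1)) = f := funext hf.1
    unfold pd
    rw [← fderiv_comp_add_right, h]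
  · intro x
    have h : (fun x => f (x + L₂ • EuclideanSpace.single 1 1)) = f := funext hf.2
    unfold pd
    rw [← fderiv_comp_add_right, h]

lemma nsq_periodic {L₁ L₂ : ℝ} {η : E2 → ℝ} (h : PeriodicE2 L₁ L₂ η) :
    PeriodicE2 L₁ L₂ (nsq η) := by
  have h0 := pd_periodic h 0
  have h1 := pd_periodic h 1
  constructor <;> intro x <;> simp only [nsq, h0.1, h0.2, h1.1, h1.2]

lemma surfD_periodic {L₁ L₂ : ℝ} {η f : E2 → ℝ} (h : PeriodicE2 L₁ L₂ η)
    (hf : PeriodicE2 L₁ L₂ f) (i : Fin 3) :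
    PeriodicE2 L₁ L₂ (surfD η i f) := by
  have h0 := pd_periodic h 0
  have h1 := pd_periodic h 1
  have f0 := pd_periodic hf 0
  have f1 := pd_periodic hf 1
  have hn := nsq_periodic h
  constructor <;> intro x <;>
    simp only [surfD, tang, nu, h0.1, h0.2, h1.1, h1.2, f0.1, f0.2, f1.1, f1.2, hn.1, hn.2]

/-- The linear identification of ℝ × ℝ with the Euclidean plane. -/
noncomputable def eE : (ℝ × ℝ) ≃L[ℝ] E2 :=
  (ContinuousLinearEquiv.finTwoArrow ℝ ℝ).symm.trans (EuclideanSpace.equiv (Fin 2) ℝ).symm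

lemma eE_zero (p : ℝ × ℝ) : eE p 0 = p.1 := rfl
lemma eE_one (p : ℝ × ℝ) : eE p 1 = p.2 := rfl

lemma eE_mp : MeasurePreserving (eE : ℝ × ℝ → E2) :=
  (PiLp.volume_preserving_toLp (Fin 2)).comp ((volume_preserving_finTwoArrow ℝ).symm _)

lemma eE_pre (L₁ L₂ : ℝ) : (eE : ℝ × ℝ → E2) ⁻¹' (Q2 L₁ L₂) = Set.Icc ((0 : ℝ), (0 : ℝ)) (L₁, L₂) := by
  ext p
  simp only [Q2, Set.mem_preimage, Set.mem_ofPred_eq, eE_zero, eE_one, Set.mem_Icc, Prod.le_def]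
  tauto

lemma Q2_compact (L₁ L₂ : ℝ) : IsCompact (Q2 L₁ L₂) := by
  have h : Q2 L₁ L₂ = eE '' (Set.Icc ((0 : ℝ), (0 : ℝ)) (L₁, L₂)) := by
    rw [← eE_pre, Set.image_preimage_eq _ eE.surjective]
  rw [h]
  exact isCompact_Icc.image eE.continuous

lemma integral_div_zero {L₁ L₂ : ℝ} (hL₁ : 0 < L₁) (hL₂ : 0 < L₂) {f g : E2 → ℝ}
    (hf : ContDiff ℝ (⊤ : ℕ∞) f) (hg : ContDiff ℝ (⊤ : ℕ∞) g)
    (pf : PeriodicE2 L₁ L₂ f) (pg : PeriodicE2 L₁ L₂ g) :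
    ∫ x in Q2 L₁ L₂, (pd 0 f x + pd 1 g x) = 0 := by
  rw [← eE_mp.setIntegral_preimage_emb eE.toHomeomorph.measurableEmbedding, eE_pre]
  have e10 : eE (1, 0) = EuclideanSpace.single 0 1 := by
    ext i; fin_cases i
    · simp [eE_zero]
    · simp [eE_one]
  have e01 : eE (0, 1) = EuclideanSpace.single 1 1 := by
    ext i; fin_cases i
    · simp [eE_zero]
    · simp [eE_one]
  have key := integral_divergence_prod_Icc_of_hasFDerivAt_of_le (fun p => f (eE p))
    (fun p => g (eE p))
    (fun p => (fderiv ℝ f (eE p)).comp (eE : ℝ × ℝ →L[ℝ] E2))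
    (fun p => (fderiv ℝ g (eE p)).comp (eE : ℝ × ℝ →L[ℝ] E2)) (0, 0) (L₁, L₂)
    ⟨hL₁.le, hL₂.le⟩
    (hf.continuous.comp eE.continuous).continuousOn
    (hg.continuous.comp eE.continuous).continuousOn
    (fun p _ => ((smd hf (eE p)).hasFDerivAt).comp p eE.hasFDerivAt)
    (fun p _ => ((smd hg (eE p)).hasFDerivAt).comp p eE.hasFDerivAt)
    (by
      simp only [ContinuousLinearMap.comp_apply, ContinuousLinearEquiv.coe_coe, e10, e01]
      exact ContinuousOn.integrableOn_compact isCompact_Icc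
        ((((pd_smooth hf 0).continuous.comp eE.continuous).add
          ((pd_smooth hg 1).continuous.comp eE.continuous)).continuousOn))
  simp only [ContinuousLinearMap.comp_apply, ContinuousLinearEquiv.coe_coe, e10, e01] at key
  have k1 : ∀ y : ℝ, f (eE (L₁, y)) = f (eE (0, y)) := by
    intro y
    rw [← pf.1 (eE (0, y)), ← e10, ← map_smul, ← map_add]
    simp
  have k2 : ∀ y : ℝ, g (eE (y, L₂)) = g (eE (y, 0)) := by
    intro y
    rw [← pg.2 (eE (y, 0)), ← e01, ← map_smul, ← map_add]
    simp
  simp only [k1, k2] at key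
  unfold pd
  rw [key]
  ring

lemma pd_slice {H : ℝ × E2 → ℝ} (hH : ContDiff ℝ (⊤ : ℕ∞) H) (i : Fin 2) (t : ℝ) (x : E2) :
    pd i (fun y => H (t, y)) x = fderiv ℝ H (t, x) (0, EuclideanSpace.single i 1) := by
  have h := (smd hH (t, x)).hasFDerivAt.comp x (hasFDerivAt_prodMk_right t x)
  unfold pd
  erw [h.fderiv]
  simp

lemma dt_slice {H : ℝ × E2 → ℝ} (hH : ContDiff ℝ (⊤ : ℕ∞) H) (t : ℝ) (x : E2) :
    HasDerivAt (fun s => H (s, x)) (fderiv ℝ H (t, x) (1, 0)) t := by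
  have h2 : HasDerivAt (fun s : ℝ => (s, x)) ((1 : ℝ), (0 : E2)) t :=
    (hasDerivAt_id t).prodMk (hasDerivAt_const t x)
  exact (smd hH (t, x)).hasFDerivAt.comp_hasDerivAt t h2

lemma slice_smooth {H : ℝ × E2 → ℝ} (hH : ContDiff ℝ (⊤ : ℕ∞) H) (t : ℝ) :
    ContDiff ℝ (⊤ : ℕ∞) (fun x => H (t, x)) :=
  hH.comp (contDiff_const.prodMk contDiff_id)

lemma dt_pd {H : ℝ × E2 → ℝ} (hH : ContDiff ℝ (⊤ : ℕ∞) H) (i : Fin 2) (t : ℝ) (x : E2) :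
    HasDerivAt (fun s => pd i (fun y => H (s, y)) x)
      (pd i (fun y => deriv (fun s => H (s, y)) t) x) t := by
  have h1 : (fun s => pd i (fun y => H (s, y)) x)
      = fun s => fderiv ℝ H (s, x) (0, EuclideanSpace.single i 1) :=
    funext fun s => pd_slice hH i s x
  have h2 : (fun y => deriv (fun s => H (s, y)) t) = fun y => fderiv ℝ H (t, y) (1, 0) :=
    funext fun y => (dt_slice hH t y).deriv
  rw [h1, h2, pd_slice (smd_fderiv hH (1, 0)), fderiv_symm hH]
  exact dt_slice (smd_fderiv hH _) t x

lemma hasDerivAt_integral_Q2 {F : ℝ × E2 → ℝ} (hF : ContDiff ℝ (⊤ : ℕ∞) F) (L₁ L₂ t : ℝ) :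
    HasDerivAt (fun s => ∫ x in Q2 L₁ L₂, F (s, x))
      (∫ x in Q2 L₁ L₂, fderiv ℝ F (t, x) (1, 0)) t := by
  have hF' := (smd_fderiv hF (1, 0)).continuous
  have hK := Q2_compact L₁ L₂
  obtain ⟨M, hM⟩ := ((isCompact_Icc (a := t - 1) (b := t + 1)).prod hK).exists_bound_of_continuousOn
    hF'.continuousOn
  have hcs : ∀ s, Continuous fun x => F (s, x) := fun s => (slice_smooth hF s).continuous
  refine (hasDerivAt_integral_of_dominated_loc_of_deriv_le (s := Set.Icc (t - 1) (t + 1))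
    (F := fun s x => F (s, x)) (F' := fun s x => fderiv ℝ F (s, x) (1, 0))
    (bound := fun _ => M) (Icc_mem_nhds (by linarith) (by linarith))
    (Filter.Eventually.of_forall fun s => (hcs s).aestronglyMeasurable)
    ((hcs t).continuousOn.integrableOn_compact hK)
    (hF'.comp (by fun_prop : Continuous fun x : E2 => (t, x))).aestronglyMeasurable
    ?_ ?_ ?_).2
  · refine (ae_restrict_iff' hK.measurableSet).2 (Filter.Eventually.of_forall ?_)
    intro x hx s hs
    exact hM (s, x) ⟨hs, hx⟩
  · exact continuousOn_const.integrableOn_compact hK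
  · exact Filter.Eventually.of_forall fun x s _ => dt_slice hF s x

end helpers

/-- Conservation of surfactant mass: t ↦ ∫_Q c̃ √(1+|∇_*η|²) has vanishing derivative. -/
theorem surfactant_mass_conservation
    (L₁ L₂ : ℝ) (hL₁ : 0 < L₁) (hL₂ : 0 < L₂) (γ : ℝ) (hγ : 0 < γ)
    (η c : ℝ → E2 → ℝ) (u : ℝ → E2 → Fin 3 → ℝ)
    (hη : ContDiff ℝ (⊤ : ℕ∞) (fun p : ℝ × E2 => η p.1 p.2))
    (hc : ContDiff ℝ (⊤ : ℕ∞) (fun p : ℝ × E2 => c p.1 p.2))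
    (hu : ContDiff ℝ (⊤ : ℕ∞) (fun p : ℝ × E2 => u p.1 p.2))
    (hηp : ∀ t, PeriodicE2 L₁ L₂ (η t))
    (hcp : ∀ t, PeriodicE2 L₁ L₂ (c t))
    (hup : ∀ t i, PeriodicE2 L₁ L₂ (fun x => u t x i))
    (heqc : ∀ t x, deriv (fun s => c s x) t
        + u t x 0 * pd 0 (c t) x + u t x 1 * pd 1 (c t) x
        + c t x * divGamma (η t) (fun i y => u t y i) x
        = γ * lapGamma (η t) (c t) x)
    (heqη : ∀ t x, deriv (fun s => η s x) t
        = (∑ i : Fin 3, u t x i * nu (η t) i x) * Real.sqrt (nsq (η t) x)) :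
    ∀ t, HasDerivAt
      (fun s => ∫ x in Q2 L₁ L₂, c s x * Real.sqrt (nsq (η s) x)) 0 t := by
  intro t
  have hηs : ∀ s, ContDiff ℝ (⊤ : ℕ∞) (η s) := slice_smooth hη
  have hcs : ∀ s, ContDiff ℝ (⊤ : ℕ∞) (c s) := slice_smooth hc
  have hus : ∀ i, ContDiff ℝ (⊤ : ℕ∞) (fun y => u t y i) := fun i =>
    slice_smooth (H := fun p : ℝ × E2 => u p.1 p.2 i) ((contDiff_pi.1 hu) i) t
  -- joint smoothness of the density
  have hF : ContDiff ℝ (⊤ : ℕ∞) (fun p : ℝ × E2 => c p.1 p.2 * Real.sqrt (nsq (η p.1) p.2)) := by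
    refine hc.mul (ContDiff.sqrt ?_ (fun p => (nsq_pos _ _).ne'))
    have hp : ∀ i, ContDiff ℝ (⊤ : ℕ∞) (fun p : ℝ × E2 => pd i (η p.1) p.2) := by
      intro i
      have h1 : (fun p : ℝ × E2 => pd i (η p.1) p.2) = fun p =>
          fderiv ℝ (fun p : ℝ × E2 => η p.1 p.2) p (0, EuclideanSpace.single i 1) :=
        funext fun p => pd_slice hη i p.1 p.2
      rw [h1]
      exact smd_fderiv hη _
    exact contDiff_const.add (((hp 0).pow 2).add ((hp 1).pow 2))
  have hmain := hasDerivAt_integral_Q2 hF L₁ L₂ t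
  -- the flux
  have hS := sq_smooth (hηs t)
  have hD := fun i => surfD_smooth (hηs t) (hcs t) i
  have ha : ∀ i, ContDiff ℝ (⊤ : ℕ∞) (fun y => Real.sqrt (nsq (η t) y) * surfD (η t) i (c t) y) :=
    fun i => hS.mul (hD i)
  have hb : ∀ i, ContDiff ℝ (⊤ : ℕ∞) (fun y => Real.sqrt (nsq (η t) y) * u t y i) :=
    fun i => hS.mul (hus i)
  have hfl : ∀ i j, ContDiff ℝ (⊤ : ℕ∞) (fun y =>
      γ * (Real.sqrt (nsq (η t) y) * surfD (η t) i (c t) y)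
        - c t y * (Real.sqrt (nsq (η t) y) * u t y j)) :=
    fun i j => (contDiff_const.mul (ha i)).sub ((hcs t).mul (hb j))
  have hpfl : ∀ i j, PeriodicE2 L₁ L₂ (fun y =>
      γ * (Real.sqrt (nsq (η t) y) * surfD (η t) i (c t) y)
        - c t y * (Real.sqrt (nsq (η t) y) * u t y j)) := by
    intro i j
    have p1 := nsq_periodic (hηp t)
    have p2 := surfD_periodic (hηp t) (hcp t) i
    have p3 := hup t j
    constructor <;> intro x
    · simp only [p1.1, p2.1, (hcp t).1, p3.1 x]
    · simp only [p1.2, p2.2, (hcp t).2, p3.2 x]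
  have hz := integral_div_zero hL₁ hL₂ (hfl 0 0) (hfl 1 1) (hpfl 0 0) (hpfl 1 1)
  rw [← hz]
  convert hmain using 3 with x
  -- pointwise identity
  have d1 := dt_slice hF t x
  have dc : HasDerivAt (fun s => c s x) (deriv (fun s => c s x) t) t :=
    (dt_slice hc t x).differentiableAt.hasDerivAt
  have d2 := dc.mul (((((dt_pd hη 0 t x).pow 2).add ((dt_pd hη 1 t x).pow 2)).const_add 1).sqrt
    (nsq_pos (η t) x).ne')
  rw [d1.unique d2]
  have hv : (fun y => deriv (fun s => η s y) t)
      = fun y => u t y 2 - u t y 0 * pd 0 (η t) y - u t y 1 * pd 1 (η t) y := by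
    funext y
    have hs : Real.sqrt (nsq (η t) y) ≠ 0 := (Real.sqrt_pos.2 (nsq_pos _ y)).ne'
    rw [heqη]
    simp [Fin.sum_univ_three, nu]
    field_simp
    ring
  have hdiv := divGamma_eq (hηs t) (X := fun i y => u t y i) hus x
  have hlap := lapGamma_eq (hηs t) (hcs t) x
  have hq := heqc t x
  have hpf : ∀ k i j, pd k (fun y =>
      γ * (Real.sqrt (nsq (η t) y) * surfD (η t) i (c t) y)
        - c t y * (Real.sqrt (nsq (η t) y) * u t y j)) x
      = γ * pd k (fun y => Real.sqrt (nsq (η t) y) * surfD (η t) i (c t) y) x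
        - (c t x * pd k (fun y => Real.sqrt (nsq (η t) y) * u t y j) x
          + Real.sqrt (nsq (η t) x) * u t x j * pd k (c t) x) := by
    intro k i j
    rw [pd_sub (contDiff_const.mul (ha i)) ((hcs t).mul (hb j)), pd_mul (hcs t) (hb j),
      pd_mul contDiff_const (ha i)]
    simp [pd]
  rw [hpf, hpf]
  simp only [hv]
  have hs : Real.sqrt (nsq (η t) x) ≠ 0 := (Real.sqrt_pos.2 (nsq_pos _ x)).ne'
  have hc' : deriv (fun s => c s x) t = γ * lapGamma (η t) (c t) x
      - u t x 0 * pd 0 (c t) x - u t x 1 * pd 1 (c t) x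
      - c t x * divGamma (η t) (fun i y => u t y i) x := by linarith
  rw [hc']
  set V := fun y => u t y 2 - u t y 0 * pd 0 (η t) y - u t y 1 * pd 1 (η t) y with hV
  have hn : Real.sqrt (1 + (pd 0 (η t) x ^ 2 + pd 1 (η t) x ^ 2)) = Real.sqrt (nsq (η t) x) := rfl
  have hW : (pd 0 (η t) x * pd 0 V x + pd 1 (η t) x * pd 1 V x) / Real.sqrt (nsq (η t) x) =
    (2 * pd 0 (η t) x * pd 0 V x + 2 * pd 1 (η t) x * pd 1 V x) / (2 * Real.sqrt (nsq (η t) x)) := by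
    field_simp
  simp only [Pi.add_apply, Pi.pow_apply]
  norm_num
  rw [hn, ← hW]
  linear_combination γ * hlap.symm - c t x * hdiv.symm
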